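/- arXiv:1506.01453 — 2 statements merged into one kernel-verified Lean document; each statement's English description precedes it below -/
import Mathlib

section
/- Let H₀ be a complex Hilbert space and let (K₁,…,Kₙ) and (L₁,…,Lₙ) be two Kraus families of bounded operators on H₀ of the same finite size n, each linearly independent over ℂ, which represent the same map: Σₖ Kₖ* A Kₖ = Σₖ Lₖ* A Lₖ for every bounded operator A on H₀. Then for every m ∈ ℕ, the linear span of the operators K_{j_m}*⋯K_{j_1}* over all multi-indices (j₁,…,j_m) ∈ {1,…,n}^m equals the linear span of the operators L_{j_m}*⋯L_{j_1}* over all multi-indices (j₁,…,j_m) ∈ {1,…,n}^m. (In particular the Stinespring subproduct system of a quantum channel is independent of the choice of minimal Kraus representation.) -/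
open ContinuousLinearMap

theorem reverse_ofFn_eq {α : Type*} {m : ℕ} (f : Fin m → α) :
    (List.ofFn f).reverse = List.ofFn fun i => f i.rev := by
  refine List.ext_getElem (by simp) fun i h₁ h₂ => ?_
  simp only [List.getElem_reverse, List.getElem_ofFn, List.length_ofFn]
  congr 1
  ext
  simp only [Fin.val_rev]
  omega

/-- The span of the reversed length-`m` words in a family is the `m`-th power of its span. -/
theorem span_range_reverse_prod_eq_pow {R A ι : Type*} [CommSemiring R] [Semiring A] [Algebra R A]
    (a : ι → A) (m : ℕ) :
    Submodule.span R (Set.range fun j : Fin m → ι =>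
        ((List.ofFn fun i : Fin m => a (j i)).reverse).prod) =
      Submodule.span R (Set.range a) ^ m := by
  rw [Submodule.span_pow]
  congr 1
  ext x
  rw [Set.mem_pow]
  constructor
  · rintro ⟨j, rfl⟩
    exact ⟨fun i => ⟨a (j i.rev), Set.mem_range_self _⟩, by simp only [reverse_ofFn_eq]⟩
  · rintro ⟨f, rfl⟩
    choose j hj using fun i => (f i).2
    refine ⟨fun i => j i.rev, ?_⟩
    simp only [reverse_ofFn_eq, Fin.rev_rev, hj]

section Kraus

variable {H : Type*} [NormedAddCommGroup H] [InnerProductSpace ℂ H] [CompleteSpace H]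

/-- The map of a Kraus family evaluated at the rank-one operator `w ↦ ⟪y, w⟫ x`. -/
theorem sum_adjoint_mul_rankOne_mul_apply {ι : Type*} [Fintype ι] (K : ι → (H →L[ℂ] H))
    (x y z : H) :
    (∑ k, adjoint (K k) * InnerProductSpace.rankOne ℂ x y * K k) z =
      (∑ k, inner ℂ y (K k z) • adjoint (K k)) x := by
  simp

/-- If two Kraus families represent the same map and the first is linearly independent, then
its adjoints lie in the span of the adjoints of the second. -/
theorem span_adjoint_le_of_kraus {ι κ : Type*} [Fintype ι] [Fintype κ]
    (K : ι → (H →L[ℂ] H)) (L : κ → (H →L[ℂ] H)) (hK : LinearIndependent ℂ K)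
    (h : ∀ A : H →L[ℂ] H, ∑ k, adjoint (K k) * A * K k = ∑ k, adjoint (L k) * A * L k) :
    Submodule.span ℂ (Set.range fun k => adjoint (K k)) ≤
      Submodule.span ℂ (Set.range fun k => adjoint (L k)) := by
  classical
  let P : Submodule ℂ (ι → ℂ) :=
    (Submodule.span ℂ (Set.range fun k => adjoint (L k))).comap
      (Fintype.linearCombination ℂ fun k => adjoint (K k))
  have mem_P (y z : H) : (fun k => inner ℂ y (K k z)) ∈ P := by
    have key : ∑ k, inner ℂ y (K k z) • adjoint (K k) =
        ∑ k, inner ℂ y (L k z) • adjoint (L k) := by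
      ext x
      rw [← sum_adjoint_mul_rankOne_mul_apply, h, sum_adjoint_mul_rankOne_mul_apply]
    rw [Submodule.mem_comap, Fintype.linearCombination_apply, key]
    exact Submodule.sum_mem _ fun k _ =>
      Submodule.smul_mem _ _ (Submodule.subset_span ⟨k, rfl⟩)
  have P_top : P = ⊤ := by
    by_contra hP
    obtain ⟨f, f_ne, hf⟩ := Submodule.exists_le_ker_of_lt_top P (lt_top_iff_ne_top.2 hP)
    have sum_zero : ∑ k, f (Pi.single k 1) • K k = 0 := by
      ext z
      refine ext_inner_left ℂ fun y => ?_
      have hyz : f (fun k => inner ℂ y (K k z)) = 0 := hf (mem_P y z)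
      rw [LinearMap.pi_apply_eq_sum_univ] at hyz
      have ite_eq_single (k : ι) : (fun j => if k = j then (1 : ℂ) else 0) = Pi.single k 1 := by
        ext j
        simp [Pi.single_apply, eq_comm]
      simpa [ite_eq_single, inner_sum, inner_smul_right, mul_comm] using hyz
    have coeff_zero := Fintype.linearIndependent_iff.1 hK _ sum_zero
    apply f_ne
    ext k
    simpa using coeff_zero k
  rw [Submodule.span_le]
  rintro _ ⟨k, rfl⟩
  have hk : Pi.single k 1 ∈ P := P_top ▸ Submodule.mem_top
  simpa [P] using hk

end Kraus

/-- The Stinespring subproduct system of a quantum channel is independent of the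
choice of (linearly independent) Kraus representation: if two linearly independent
Kraus families of the same size `n` represent the same map, then for every `m`
the spans of the length-`m` products of adjoints coincide. -/
theorem stmt_0 {H : Type*} [NormedAddCommGroup H] [InnerProductSpace ℂ H] [CompleteSpace H]
    {n : ℕ} (K L : Fin n → (H →L[ℂ] H))
    (hK : LinearIndependent ℂ K) (hL : LinearIndependent ℂ L)
    (h : ∀ A : H →L[ℂ] H,
      ∑ k, adjoint (K k) * A * K k = ∑ k, adjoint (L k) * A * L k)
    (m : ℕ) :
    Submodule.span ℂ (Set.range fun j : Fin m → Fin n =>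
        ((List.ofFn fun i : Fin m => adjoint (K (j i))).reverse).prod) =
    Submodule.span ℂ (Set.range fun j : Fin m → Fin n =>
        ((List.ofFn fun i : Fin m => adjoint (L (j i))).reverse).prod) := by
  rw [span_range_reverse_prod_eq_pow (fun k => adjoint (K k)),
    span_range_reverse_prod_eq_pow (fun k => adjoint (L k)),
    le_antisymm (span_adjoint_le_of_kraus K L hK h)
      (span_adjoint_le_of_kraus L K hL fun A => (h A).symm)]
end

section
/- Let H₀ be a complex Hilbert space and let (K₁,…,Kₙ) and (L₁,…,Lₙ) be two linearly independent Kraus families of bounded operators on H₀ of the same finite size n satisfying Σₖ Kₖ* A Kₖ = Σₖ Lₖ* A Lₖ for every bounded operator A on H₀. Then there exists a unitary n×n complex matrix u such that L_j = Σ_{k=1}^n u_{jk} K_k for every j = 1,…,n. -/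
open ContinuousLinearMap

/-- Two Kraus families of the same map have the same contractions, viewed as operators. -/
theorem sum_inner_smul_eq_of_kraus_eq {H ι : Type*} [NormedAddCommGroup H]
    [InnerProductSpace ℂ H] [CompleteSpace H] [Fintype ι] {K L : ι → (H →L[ℂ] H)}
    (h : ∀ A : H →L[ℂ] H,
      ∑ k, adjoint (K k) * A * K k = ∑ k, adjoint (L k) * A * L k) (y z : H) :
    ∑ k, inner ℂ (K k y) z • K k = ∑ k, inner ℂ (L k y) z • L k := by
  ext x
  refine ext_inner_left ℂ fun w => ?_
  have := congrArg (fun T : H →L[ℂ] H => inner ℂ y (T x)) (h (InnerProductSpace.rankOne ℂ z w))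
  simp only [sum_apply, mul_apply_eq_comp,
    InnerProductSpace.rankOne_apply, map_smul, inner_sum, inner_smul_right,
    adjoint_inner_right] at this
  simp only [sum_apply, smul_apply, inner_sum,
    inner_smul_right]
  simpa only [mul_comm] using this

/-- The coordinate vectors of matrix coefficients of a linearly independent family of operators
span the coordinate space. -/
theorem span_range_inner_apply_eq_top {H ι : Type*} [NormedAddCommGroup H]
    [InnerProductSpace ℂ H] [Fintype ι] {L : ι → (H →L[ℂ] H)} (hL : LinearIndependent ℂ L) :
    Submodule.span ℂ (Set.range fun p : H × H => fun k => inner ℂ (L k p.1) p.2) = ⊤ := by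
  classical
  by_contra hT
  obtain ⟨f, hf, hle⟩ := Submodule.exists_le_ker_of_lt_top _ (lt_top_iff_ne_top.mpr hT)
  have hzero : ∑ k, star (f (Pi.single k 1)) • L k = 0 := by
    ext y
    refine ext_inner_right ℂ fun z => ?_
    have hmem := hle (Submodule.subset_span ⟨(y, z), rfl⟩)
    rw [LinearMap.mem_ker, LinearMap.pi_apply_eq_sum_univ] at hmem
    have hsingle : ∀ k : ι, (fun j => if k = j then (1 : ℂ) else 0) = Pi.single k 1 := by
      intro k
      ext j
      simp [Pi.single_apply, eq_comm]
    simp only [hsingle, smul_eq_mul] at hmem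
    simpa [sum_inner, inner_smul_left, mul_comm] using hmem
  have hcoeff := Fintype.linearIndependent_iff.mp hL _ hzero
  refine hf (LinearMap.pi_ext' fun k => LinearMap.ext_ring ?_)
  simpa using hcoeff k

/-- Two linearly independent Kraus families of the same size representing the same
channel are related by a unitary matrix: `L j = ∑ k, u j k • K k`. -/
theorem stmt_1 {H : Type*} [NormedAddCommGroup H] [InnerProductSpace ℂ H] [CompleteSpace H]
    {n : ℕ} (K L : Fin n → (H →L[ℂ] H))
    (hK : LinearIndependent ℂ K) (hL : LinearIndependent ℂ L)
    (h : ∀ A : H →L[ℂ] H,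
      ∑ k, adjoint (K k) * A * K k = ∑ k, adjoint (L k) * A * L k) :
    ∃ u : Matrix (Fin n) (Fin n) ℂ, u ∈ Matrix.unitaryGroup (Fin n) ℂ ∧
      ∀ j, L j = ∑ k, u j k • K k := by
  have hcontr := sum_inner_smul_eq_of_kraus_eq h
  have hspan : ∀ c : Fin n → ℂ, ∑ k, c k • L k ∈ Submodule.span ℂ (Set.range K) := by
    have hle : Submodule.span ℂ (Set.range fun p : H × H => fun k => inner ℂ (L k p.1) p.2) ≤
        (Submodule.span ℂ (Set.range K)).comap (Fintype.linearCombination ℂ L) := by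
      rw [Submodule.span_le]
      rintro _ ⟨⟨y, z⟩, rfl⟩
      simp only [Submodule.comap_coe, Set.mem_preimage, SetLike.mem_coe,
        Fintype.linearCombination_apply, ← hcontr]
      exact Submodule.sum_mem _ fun k _ =>
        Submodule.smul_mem _ _ (Submodule.subset_span ⟨k, rfl⟩)
    rw [span_range_inner_apply_eq_top hL] at hle
    exact fun c => hle (Submodule.mem_top (x := c))
  have hexists : ∀ j, ∃ c : Fin n → ℂ, ∑ k, c k • K k = L j := fun j =>
    (Submodule.mem_span_range_iff_exists_fun ℂ).mp
      (by simpa [Pi.single_apply, ite_smul] using hspan (Pi.single j 1))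
  choose u hu using hexists
  refine ⟨Matrix.of u, ?_, fun j => (hu j).symm⟩
  have hKL : ∀ k, K k = ∑ j, star (u j k) • L j := by
    intro k
    ext y
    refine ext_inner_right ℂ fun z => ?_
    have heq : ∑ k, inner ℂ (K k y) z • K k =
        ∑ k, (∑ j, inner ℂ (L j y) z * u j k) • K k := by
      rw [hcontr]
      simp_rw [Finset.sum_smul, mul_smul]
      rw [Finset.sum_comm]
      simp_rw [← Finset.smul_sum, hu]
    have := hK.fintypeLinearCombination_injective
      (by simpa only [Fintype.linearCombination_apply] using heq)
    simpa [sum_inner, inner_smul_left, mul_comm] using congrFun this k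
  rw [Matrix.mem_unitaryGroup_iff']
  ext k l
  have heq : ∑ l, (star (Matrix.of u) * Matrix.of u) k l • K l =
      ∑ l, (1 : Matrix (Fin n) (Fin n) ℂ) k l • K l := by
    simp only [Matrix.mul_apply, Matrix.star_apply, Matrix.of_apply, Finset.sum_smul, mul_smul]
    rw [Finset.sum_comm]
    simp_rw [← Finset.smul_sum, hu, ← hKL]
    simp [Matrix.one_apply]
  have := hK.fintypeLinearCombination_injective
    (by simpa only [Fintype.linearCombination_apply] using heq)
  exact congrFun this l
end
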